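/- Let 0 ≤ s ≤ n−2 and let G be a connected graph on n vertices with exactly s cut vertices. Let l'_1,…,l'_{n−s} be positive integers with l'_1+⋯+l'_{n−s} = n and |l'_i − l'_j| ≤ 1 for all i, j ∈ {1,…,n−s}. Then ε(K_{n−s}^n(l'_1,…,l'_{n−s})) ≤ ε(G). -/

import Mathlib

open SimpleGraph

/-- The eccentricity of a vertex: maximum distance to any vertex. -/
noncomputable def ecc {V : Type*} (G : SimpleGraph V) (v : V) : ℕ :=
  ⨆ u, G.dist v u

/-- The total eccentricity index: sum of eccentricities of all vertices. -/
noncomputable def totalEcc {V : Type*} [Fintype V] (G : SimpleGraph V) : ℕ :=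
  ∑ v, ecc G v

/-- A pendant vertex: a vertex of degree one, i.e. with exactly one neighbour. -/
def IsPendant {V : Type*} (G : SimpleGraph V) (v : V) : Prop :=
  ∃! u, G.Adj v u

/-- A cut vertex: a vertex whose removal disconnects the graph. -/
def IsCutVertex {V : Type*} (G : SimpleGraph V) (w : V) : Prop :=
  ¬ (G.induce {v | v ≠ w}).Connected

/-- distance between two subgraphs -/
noncomputable def subgraphDist {V : Type*} (G : SimpleGraph V) (B B' : G.Subgraph) : ℕ :=
  sInf {d | ∃ u ∈ B.verts, ∃ w ∈ B'.verts, G.dist u w = d}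

/-- A 2-connected subgraph: at least two vertices, connected, and no cut vertex. -/
def TwoConn {V : Type*} {G : SimpleGraph V} (H : G.Subgraph) : Prop :=
  2 ≤ H.verts.ncard ∧ H.coe.Connected ∧ ∀ w, ¬ IsCutVertex H.coe w

/-- A block: a maximal 2-connected subgraph. -/
def IsBlock {V : Type*} {G : SimpleGraph V} (H : G.Subgraph) : Prop :=
  TwoConn H ∧ ∀ H' : G.Subgraph, H ≤ H' → TwoConn H' → H' = H

/-- A pendant block: a block containing exactly one cut vertex of `G`. -/
def IsPendantBlock {V : Type*} (G : SimpleGraph V) (H : G.Subgraph) : Prop :=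
  ∃! w, w ∈ H.verts ∧ IsCutVertex G w

/-- `G_{k,l}`: the graph obtained from `G` by attaching two new paths,
with `k` resp. `l` new vertices, at the vertex `v`. -/
def attachTwoPaths {V : Type*} (G : SimpleGraph V) (v : V) (k l : ℕ) :
    SimpleGraph (V ⊕ (Fin k ⊕ Fin l)) :=
  SimpleGraph.fromRel (fun p q =>
    match p, q with
    | .inl x, .inl y => G.Adj x y
    | .inl x, .inr (.inl i) => x = v ∧ i.val = 0
    | .inl x, .inr (.inr i) => x = v ∧ i.val = 0
    | .inr (.inl i), .inr (.inl j) => i.val + 1 = j.val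
    | .inr (.inr i), .inr (.inr j) => i.val + 1 = j.val
    | _, _ => False)

/-- The graph obtained from `H1`, `H2` and the path `P_d = v_1 v_2 … v_d` by identifying
`u ∈ V(H1)`, `v ∈ V(H2)` and `v_1` into a single vertex.  The `Fin (d-1)` part records the
path vertices `v_2, …, v_d`. -/
def glueMid {V1 V2 : Type*} (H1 : SimpleGraph V1) (H2 : SimpleGraph V2)
    (u : V1) (v : V2) (d : ℕ) :
    SimpleGraph (V1 ⊕ ({x : V2 // x ≠ v} ⊕ Fin (d - 1))) :=
  SimpleGraph.fromRel (fun p q =>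
    match p, q with
    | .inl x, .inl y => H1.Adj x y
    | .inl x, .inr (.inl y) => x = u ∧ H2.Adj v y.1
    | .inl x, .inr (.inr i) => x = u ∧ i.val = 0
    | .inr (.inl x), .inr (.inl y) => H2.Adj x.1 y.1
    | .inr (.inr i), .inr (.inr j) => i.val + 1 = j.val
    | _, _ => False)

/-- The graph obtained from `H1`, `H2` and the path `P_d = v_1 v_2 … v_d` by identifying
`u ∈ V(H1)` with `v_1` and `v ∈ V(H2)` with `v_d`.  The `Fin (d-1)` part records the path
vertices `v_2, …, v_d` (the last one being identified with `v`). -/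
def glueEnds {V1 V2 : Type*} (H1 : SimpleGraph V1) (H2 : SimpleGraph V2)
    (u : V1) (v : V2) (d : ℕ) :
    SimpleGraph (V1 ⊕ ({x : V2 // x ≠ v} ⊕ Fin (d - 1))) :=
  SimpleGraph.fromRel (fun p q =>
    match p, q with
    | .inl x, .inl y => H1.Adj x y
    | .inl x, .inr (.inr i) => x = u ∧ i.val = 0
    | .inr (.inl x), .inr (.inl y) => H2.Adj x.1 y.1
    | .inr (.inr i), .inr (.inl y) => i.val + 1 = d - 1 ∧ H2.Adj v y.1
    | .inr (.inr i), .inr (.inr j) => i.val + 1 = j.val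
    | _, _ => False)

/-- `U_{n,g}^l`: the unicyclic graph on `n` vertices obtained by joining one end vertex of
the path `P_{n-g}` to a vertex of the cycle `C_g` by an edge. -/
def UnlGraph (n g : ℕ) : SimpleGraph (Fin (n - g) ⊕ Fin g) :=
  SimpleGraph.fromRel (fun p q =>
    match p, q with
    | .inl i, .inl j => i.val + 1 = j.val
    | .inl i, .inr j => i.val + 1 = n - g ∧ j.val = 0
    | .inr i, .inr j => i.val + 1 = j.val ∨ (i.val = 0 ∧ j.val + 1 = g)
    | _, _ => False)

/-- `U_{n,g}^p`: the unicyclic graph on `n` vertices obtained by attaching `n - g` pendant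
vertices to one vertex of the cycle `C_g`. -/
def UnpGraph (n g : ℕ) : SimpleGraph (Fin g ⊕ Fin (n - g)) :=
  SimpleGraph.fromRel (fun p q =>
    match p, q with
    | .inl i, .inl j => i.val + 1 = j.val ∨ (i.val = 0 ∧ j.val + 1 = g)
    | .inl i, .inr _ => i.val = 0
    | _, _ => False)

/-- The graph obtained by joining the vertex `u` of `H` to the pendant vertex of
`U_{r,g}^l` by an edge. -/
def joinPendant {V : Type*} (H : SimpleGraph V) (u : V) (r g : ℕ) :
    SimpleGraph (V ⊕ (Fin (r - g) ⊕ Fin g)) :=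
  SimpleGraph.fromRel (fun p q =>
    match p, q with
    | .inl x, .inl y => H.Adj x y
    | .inl x, .inr (.inl i) => x = u ∧ i.val = 0
    | .inr a, .inr b => (UnlGraph r g).Adj a b
    | _, _ => False)

/-- `C_{m1,m2}^n` in the case `n = m1 + m2 - 1`: two cycles `C_{m1}` and `C_{m2}`
sharing exactly one vertex (the vertex `0`). -/
def twoCyclesGlued (m1 m2 : ℕ) : SimpleGraph (Fin (m1 + m2 - 1)) :=
  SimpleGraph.fromRel (fun i j =>
    (i.val + 1 = j.val ∧ j.val < m1) ∨ (i.val = 0 ∧ j.val + 1 = m1)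
    ∨ (i.val = 0 ∧ j.val = m1) ∨ (m1 ≤ i.val ∧ i.val + 1 = j.val)
    ∨ (i.val = 0 ∧ j.val + 2 = m1 + m2))

/-- `C_{3,3}^n` for `n > 5`: two triangles `{0,1,2}` and `{n-3,n-2,n-1}` joined by the path
`2, 3, …, n-3` (a path on `n - 4` vertices whose ends are identified with a vertex of each
triangle). -/
def C33 (n : ℕ) : SimpleGraph (Fin n) :=
  SimpleGraph.fromRel (fun i j =>
    (i.val = 0 ∧ j.val = 1) ∨ (i.val = 0 ∧ j.val = 2) ∨ (i.val = 1 ∧ j.val = 2)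
    ∨ (2 ≤ i.val ∧ i.val + 1 = j.val ∧ j.val + 3 ≤ n)
    ∨ (i.val + 3 = n ∧ j.val + 2 = n) ∨ (i.val + 2 = n ∧ j.val + 1 = n)
    ∨ (i.val + 3 = n ∧ j.val + 1 = n))

/-- `T(l, m, d)`: the tree obtained from the path `P_d` by attaching `l` pendant vertices at
one end and `m` pendant vertices at the other end. -/
def Tlmd (l m d : ℕ) : SimpleGraph (Fin d ⊕ (Fin l ⊕ Fin m)) :=
  SimpleGraph.fromRel (fun p q =>
    match p, q with
    | .inl i, .inl j => i.val + 1 = j.val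
    | .inl i, .inr (.inl _) => i.val = 0
    | .inl i, .inr (.inr _) => i.val + 1 = d
    | _, _ => False)

/-- `K_m^n(l_1, …, l_m)`: the graph obtained from the complete graph `K_m` by identifying,
for each `i`, one end vertex of a path on `l i` vertices with the `i`-th vertex of `K_m`.
The vertex `⟨i, 0⟩` is the `i`-th vertex of the complete graph. -/
def Kmn (m : ℕ) (l : Fin m → ℕ) : SimpleGraph ((i : Fin m) × Fin (l i)) :=
  SimpleGraph.fromRel (fun p q =>
    (p.1 = q.1 ∧ p.2.val + 1 = q.2.val) ∨ (p.1 ≠ q.1 ∧ p.2.val = 0 ∧ q.2.val = 0))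

/-- The graph obtained from `H`, `C_{m1}` and `C_{m2}` by identifying the vertex `w` of `H`,
a vertex of `C_{m1}` and a vertex of `C_{m2}` into one vertex. -/
def glueTwoCycles {V : Type*} (H : SimpleGraph V) (w : V) (m1 m2 : ℕ) :
    SimpleGraph (V ⊕ (Fin (m1 - 1) ⊕ Fin (m2 - 1))) :=
  SimpleGraph.fromRel (fun p q =>
    match p, q with
    | .inl x, .inl y => H.Adj x y
    | .inl x, .inr (.inl i) => x = w ∧ (i.val = 0 ∨ i.val + 2 = m1)
    | .inl x, .inr (.inr i) => x = w ∧ (i.val = 0 ∨ i.val + 2 = m2)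
    | .inr (.inl i), .inr (.inl j) => i.val + 1 = j.val
    | .inr (.inr i), .inr (.inr j) => i.val + 1 = j.val
    | _, _ => False)

/-- The graph obtained from `H` and the cycle `C_M` by identifying the vertex `w` of `H`
with one vertex of the cycle. -/
def glueOneCycle {V : Type*} (H : SimpleGraph V) (w : V) (M : ℕ) :
    SimpleGraph (V ⊕ Fin (M - 1)) :=
  SimpleGraph.fromRel (fun p q =>
    match p, q with
    | .inl x, .inl y => H.Adj x y
    | .inl x, .inr i => x = w ∧ (i.val = 0 ∨ i.val + 2 = M)
    | .inr i, .inr j => i.val + 1 = j.val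
    | _, _ => False)

section AvoidingWalks

variable {V : Type*} {G : SimpleGraph V}

/-- `a` and `b` are joined by a walk that does not visit `v`. -/
def ReachableAvoiding (G : SimpleGraph V) (v a b : V) : Prop :=
  ∃ p : G.Walk a b, v ∉ p.support

theorem ReachableAvoiding.refl {v a : V} (h : a ≠ v) : ReachableAvoiding G v a a :=
  ⟨Walk.nil, by simpa using h.symm⟩

theorem ReachableAvoiding.symm {v a b : V} (h : ReachableAvoiding G v a b) :
    ReachableAvoiding G v b a := by
  obtain ⟨p, hp⟩ := h
  exact ⟨p.reverse, by simpa using hp⟩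

theorem ReachableAvoiding.trans {v a b c : V} (h : ReachableAvoiding G v a b)
    (h' : ReachableAvoiding G v b c) : ReachableAvoiding G v a c := by
  obtain ⟨p, hp⟩ := h
  obtain ⟨q, hq⟩ := h'
  exact ⟨p.append q, by simp [Walk.mem_support_append_iff, hp, hq]⟩

theorem ReachableAvoiding.reachable_induce {v a b : V} (h : ReachableAvoiding G v a b)
    (ha : a ≠ v) (hb : b ≠ v) :
    (G.induce {x | x ≠ v}).Reachable ⟨a, ha⟩ ⟨b, hb⟩ := by
  obtain ⟨p, hp⟩ := h
  exact ⟨p.induce {x | x ≠ v} fun x hx hxv => hp (hxv ▸ hx)⟩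

/-- If every walk from `a` to `b` visits `v`, then `v` lies on a geodesic from `a` to `b`. -/
theorem dist_eq_add_of_not_reachableAvoiding (hG : G.Connected) {v a b : V}
    (h : ¬ ReachableAvoiding G v a b) : G.dist a b = G.dist a v + G.dist v b := by
  classical
  obtain ⟨p, hp⟩ := hG.exists_walk_length_eq_dist a b
  have hv : v ∈ p.support := by
    by_contra hv
    exact h ⟨p, hv⟩
  refine le_antisymm hG.dist_triangle ?_
  have hlen := congrArg Walk.length (p.take_spec hv)
  rw [Walk.length_append] at hlen
  have h₁ := dist_le (p.takeUntil v hv)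
  have h₂ := dist_le (p.dropUntil v hv)
  omega

theorem IsCutVertex.exists_not_reachableAvoiding {u v : V} (hv : IsCutVertex G v) (hu : u ≠ v) :
    ∃ y, y ≠ v ∧ ¬ ReachableAvoiding G v u y := by
  by_contra! h
  have : Nonempty {x | x ≠ v} := ⟨⟨u, hu⟩⟩
  refine hv ⟨fun a b => ?_⟩
  exact ((h a a.2).symm.trans (h b b.2)).reachable_induce a.2 b.2

/-- Among the vertices separated from `u` by a cut vertex `v` there is one that is not a
cut vertex. -/
theorem IsCutVertex.exists_not_isCutVertex [Finite V] (hG : G.Connected) {u v : V}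
    (hv : IsCutVertex G v) (hu : u ≠ v) :
    ∃ w, w ≠ v ∧ ¬ ReachableAvoiding G v u w ∧ ¬ IsCutVertex G w := by
  obtain ⟨w, ⟨hwv, huw⟩, hmax⟩ := Set.exists_max_image
    {y | y ≠ v ∧ ¬ ReachableAvoiding G v u y} (G.dist u) (Set.toFinite _)
    (hv.exists_not_reachableAvoiding hu)
  refine ⟨w, hwv, huw, fun hw => ?_⟩
  have hne : u ≠ w := by
    rintro rfl
    exact huw (.refl hu)
  obtain ⟨y, hyw, hy⟩ := hw.exists_not_reachableAvoiding hne
  have h₁ := dist_eq_add_of_not_reachableAvoiding hG huw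
  have h₂ := dist_eq_add_of_not_reachableAvoiding hG hy
  have h₃ := hG.pos_dist_of_ne hwv
  have h₄ := hG.pos_dist_of_ne hyw
  have hvw : G.dist v w = G.dist w v := dist_comm
  have hwy : G.dist w y = G.dist y w := dist_comm
  have hyv : G.dist y v = G.dist v y := dist_comm
  by_cases hyv' : y = v
  · subst hyv'
    omega
  by_cases huy : ReachableAvoiding G v u y
  · have h₅ := dist_eq_add_of_not_reachableAvoiding hG fun h => huw (huy.trans h)
    have h₆ : G.dist u y ≤ G.dist u v + G.dist v y := hG.dist_triangle
    omega
  · have := hmax y ⟨hyv', huy⟩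
    omega

end AvoidingWalks

section LevelSets

variable {V : Type*} [Fintype V] {G : SimpleGraph V}

open Classical in
/-- If every cut vertex on the level `k` of `f` has a base vertex from which it only separates
vertices on higher levels, then the level is at most as large as the set of non-cut vertices on
the levels `≥ k`. -/
theorem card_level_le (hG : G.Connected) (f : V → ℕ) (k : ℕ)
    (h : ∀ v, IsCutVertex G v → f v = k →
      ∃ u, u ≠ v ∧ ∀ y, y ≠ v → ¬ ReachableAvoiding G v u y → k < f y) :
    (Finset.univ.filter fun v => f v = k).card ≤
      (Finset.univ.filter fun v => ¬ IsCutVertex G v ∧ k ≤ f v).card := by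
  have key : ∀ v, IsCutVertex G v → f v = k → ∃ w u, w ≠ v ∧ ¬ IsCutVertex G w ∧ k < f w ∧
      ¬ ReachableAvoiding G v u w ∧
      ∀ y, y ≠ v → ¬ ReachableAvoiding G v u y → k < f y := by
    intro v hv hk
    obtain ⟨u, hu, hsep⟩ := h v hv hk
    obtain ⟨w, hwv, huw, hw⟩ := hv.exists_not_isCutVertex hG hu
    exact ⟨w, u, hwv, hw, hsep w hwv huw, huw, hsep⟩
  choose! φ u hφ using key
  refine Finset.card_le_card_of_injOn (fun v => if IsCutVertex G v then φ v else v) ?_ ?_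
  · intro v hv
    have hk : f v = k := by simpa using hv
    by_cases hc : IsCutVertex G v
    · simpa [hc] using ⟨(hφ v hc hk).2.1, (hφ v hc hk).2.2.1.le⟩
    · simp [hc, hk]
  · intro v hv v' hv' heq
    have hk : f v = k := by simpa using hv
    have hk' : f v' = k := by simpa using hv'
    by_cases hc : IsCutVertex G v <;> by_cases hc' : IsCutVertex G v'
    · by_contra hne
      simp only [hc, hc', if_true] at heq
      obtain ⟨-, -, -, h₁, h₂⟩ := hφ v hc hk
      obtain ⟨-, -, -, h₁', h₂'⟩ := hφ v' hc' hk'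
      have hr : ReachableAvoiding G v (u v) v' := by
        by_contra hr
        have := h₂ v' (Ne.symm hne) hr
        omega
      have hr' : ReachableAvoiding G v' (u v') v := by
        by_contra hr'
        have := h₂' v hne hr'
        omega
      have d := dist_eq_add_of_not_reachableAvoiding hG fun h => h₁ (hr.trans h)
      have d' := dist_eq_add_of_not_reachableAvoiding hG fun h => h₁' (hr'.trans h)
      rw [← heq] at d'
      have := hG.pos_dist_of_ne hne
      omega
    · simp only [hc, hc', if_true, if_false] at heq
      have := (hφ v hc hk).2.2.1
      rw [heq] at this
      omega
    · simp only [hc, hc', if_true, if_false] at heq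
      have := (hφ v' hc' hk').2.2.1
      rw [← heq] at this
      omega
    · simpa [hc, hc'] using heq

theorem dist_le_ecc (G : SimpleGraph V) (v u : V) : G.dist v u ≤ ecc G v :=
  le_ciSup (Set.finite_range (G.dist v)).bddAbove u

theorem exists_dist_eq_ecc [Nonempty V] (G : SimpleGraph V) (v : V) :
    ∃ u, G.dist v u = ecc G v :=
  exists_eq_ciSup_of_finite

theorem ecc_pos [Nontrivial V] (hG : G.Connected) (v : V) : 0 < ecc G v := by
  obtain ⟨u, hu⟩ := exists_ne v
  exact (hG.pos_dist_of_ne hu.symm).trans_le (dist_le_ecc G v u)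

open Classical in
theorem card_ecc_level_le [Nontrivial V] (hG : G.Connected) (k : ℕ) :
    (Finset.univ.filter fun v => ecc G v = k).card ≤
      (Finset.univ.filter fun v => ¬ IsCutVertex G v).card := by
  refine (card_level_le hG (ecc G) k fun v _ hk => ?_).trans
    (Finset.card_le_card fun v hv => by simp_all)
  obtain ⟨u, hu⟩ := exists_dist_eq_ecc G v
  have hpos := ecc_pos hG v
  refine ⟨u, ?_, fun y hy hsep => ?_⟩
  · rintro rfl
    simp at hu
    omega
  · have h₁ := dist_eq_add_of_not_reachableAvoiding hG hsep
    have h₂ := dist_le_ecc G y u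
    have h₃ := hG.pos_dist_of_ne hy
    rw [dist_comm (u := y)] at h₂ h₃
    rw [dist_comm (u := u) (v := v)] at h₁
    omega

open Classical in
theorem card_dist_level_le (hG : G.Connected) (x : V) {k : ℕ} (hk : 0 < k) :
    (Finset.univ.filter fun v => G.dist x v = k).card ≤
      (Finset.univ.filter fun v => ¬ IsCutVertex G v ∧ k ≤ G.dist x v).card := by
  refine card_level_le hG (G.dist x) k fun v _ hv => ⟨x, ?_, fun y hy hsep => ?_⟩
  · rintro rfl
    simp at hv
    omega
  · have h₁ := dist_eq_add_of_not_reachableAvoiding hG hsep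
    have h₂ := hG.pos_dist_of_ne hy.symm
    omega

open Classical in
theorem card_eq_one_add_sum_dist_levels (hG : G.Connected) (x : V) :
    Fintype.card V = 1 + ∑ k ∈ Finset.range (ecc G x),
      (Finset.univ.filter fun v => G.dist x v = k + 1).card := by
  have h := Finset.card_eq_sum_card_fiberwise (f := G.dist x) (s := Finset.univ)
    (t := Finset.range (ecc G x + 1)) fun v _ => by
      simpa using Nat.lt_succ_of_le (dist_le_ecc G x v)
  rw [Finset.card_univ, Finset.sum_range_succ'] at h
  have h₀ : (Finset.univ.filter fun v => G.dist x v = 0) = {x} := by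
    ext v
    simp [hG.dist_eq_zero_iff, eq_comm]
  rw [h, h₀, Finset.card_singleton, add_comm]

open Classical in
theorem card_le_one_add_mul_ecc (hG : G.Connected) (x : V) :
    Fintype.card V ≤ 1 + ecc G x * (Finset.univ.filter fun v => ¬ IsCutVertex G v).card := by
  rw [card_eq_one_add_sum_dist_levels hG x]
  gcongr
  refine (Finset.sum_le_card_nsmul _ _ (Finset.univ.filter fun v => ¬ IsCutVertex G v).card
    fun k _ => ?_).trans (by simp)
  exact (card_dist_level_le hG x k.succ_pos).trans (Finset.card_le_card fun v hv => by simp_all)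

open Classical in
/-- If the bound `card_le_one_add_mul_ecc` is attained, then every non-cut vertex is at the
largest possible distance from `x`. -/
theorem dist_eq_ecc_of_card_eq [Nontrivial V] (hG : G.Connected) {x : V}
    (hx : Fintype.card V =
      1 + ecc G x * (Finset.univ.filter fun v => ¬ IsCutVertex G v).card)
    {z : V} (hz : ¬ IsCutVertex G z) : G.dist x z = ecc G x := by
  by_contra hne
  have hlt := lt_of_le_of_ne (dist_le_ecc G x z) hne
  have hpos := ecc_pos hG x
  have hsum : ∑ k ∈ Finset.range (ecc G x),
      (Finset.univ.filter fun v => G.dist x v = k + 1).card <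
      ∑ _k ∈ Finset.range (ecc G x),
        (Finset.univ.filter fun v => ¬ IsCutVertex G v).card := by
    refine Finset.sum_lt_sum (fun k _ => ?_) ⟨ecc G x - 1, by simp [hpos], ?_⟩
    · exact (card_dist_level_le hG x k.succ_pos).trans
        (Finset.card_le_card fun v hv => by simp_all)
    · refine (card_dist_level_le hG x (Nat.succ_pos _)).trans_lt
        (Finset.card_lt_card ⟨fun v hv => by simp_all, fun hsub => ?_⟩)
      have := hsub (Finset.mem_filter.2 ⟨Finset.mem_univ z, hz⟩)
      simp only [Finset.mem_filter] at this
      omega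
  rw [Finset.sum_const, Finset.card_range, smul_eq_mul] at hsum
  have := card_eq_one_add_sum_dist_levels hG x
  omega

open Classical in
/-- At most one vertex attains the bound `card_le_one_add_mul_ecc`. -/
theorem eq_of_card_eq [Nontrivial V] (hG : G.Connected) {x y : V}
    (hx : Fintype.card V =
      1 + ecc G x * (Finset.univ.filter fun v => ¬ IsCutVertex G v).card)
    (hy : ecc G y = ecc G x) : x = y := by
  by_contra hxy
  have hy' := hx
  rw [← hy] at hy'
  by_cases hc : IsCutVertex G y
  · obtain ⟨w, -, hsep, hw⟩ := hc.exists_not_isCutVertex hG hxy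
    have h₁ := dist_eq_add_of_not_reachableAvoiding hG hsep
    have h₂ := dist_eq_ecc_of_card_eq hG hx hw
    have h₃ := dist_eq_ecc_of_card_eq hG hy' hw
    have := hG.pos_dist_of_ne hxy
    omega
  · have h₁ := dist_eq_ecc_of_card_eq hG hy' hc
    have := ecc_pos hG y
    simp at h₁
    omega

/-- If `f` takes no value below `Q`, at most `c` times the value `Q`, and each larger value
at most `m` times, then its sum is bounded below. -/
theorem card_mul_le_sum_add (f : V → ℕ) (m c Q : ℕ) (hf : ∀ v, Q ≤ f v)
    (hc : (Finset.univ.filter fun v => f v = Q).card ≤ c)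
    (hm : ∀ k, (Finset.univ.filter fun v => f v = k).card ≤ m) :
    Fintype.card V * (2 * Q + 1) ≤
      ∑ v, f v + (c * (Q + 1) + m * ∑ a ∈ Finset.range (Q + 1), (Q - a)) := by
  have h₁ : Fintype.card V * (2 * Q + 1) ≤ ∑ v, f v + ∑ v, (2 * Q + 1 - f v) := by
    rw [← Finset.sum_add_distrib, ← smul_eq_mul, ← Finset.card_univ]
    exact Finset.card_nsmul_le_sum _ _ _ fun v _ => by omega
  refine h₁.trans (Nat.add_le_add_left ?_ _)
  have h₂ : ∀ v, 2 * Q + 1 - f v =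
      ∑ a ∈ Finset.range (Q + 2), if f v = Q + a then Q + 1 - a else 0 := by
    intro v
    obtain ⟨b, hb⟩ := Nat.exists_eq_add_of_le (hf v)
    simp only [hb, Nat.add_left_cancel_iff, Finset.sum_ite_eq, Finset.mem_range]
    split_ifs <;> omega
  rw [Finset.sum_congr rfl fun v _ => h₂ v, Finset.sum_comm, Finset.sum_range_succ',
    add_comm, Finset.mul_sum]
  simp only [← Finset.sum_filter, Finset.sum_const, smul_eq_mul]
  refine Nat.add_le_add (by simpa using Nat.mul_le_mul_right (Q + 1) hc)
    (Finset.sum_le_sum fun a _ => ?_)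
  rw [Nat.add_sub_add_right]
  exact Nat.mul_le_mul_right _ (hm _)

end LevelSets

section CompleteWithPaths

variable {m : ℕ} {l : Fin m → ℕ}

theorem Kmn_exists_walk_of_add_eq (i : Fin m) (d : ℕ) :
    ∀ a b : Fin (l i), a.val + d = b.val →
      ∃ p : (Kmn m l).Walk ⟨i, a⟩ ⟨i, b⟩, p.length = d := by
  induction d with
  | zero =>
    intro a b h
    obtain rfl : a = b := Fin.ext h
    exact ⟨.nil, rfl⟩
  | succ d ih =>
    intro a b h
    obtain ⟨p, hp⟩ := ih a ⟨a.val + d, by omega⟩ rfl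
    have hadj : (Kmn m l).Adj ⟨i, ⟨a.val + d, by omega⟩⟩ ⟨i, b⟩ := by
      refine (fromRel_adj _ _ _).2 ⟨fun he => ?_, .inl (.inl ⟨rfl, by simp only; omega⟩)⟩
      have := congrArg Fin.val (eq_of_heq (Sigma.mk.inj he).2)
      simp only at this
      omega
    exact ⟨p.concat hadj, by simp [hp]⟩

theorem Kmn_dist_same_le (i : Fin m) (a b : Fin (l i)) :
    (Kmn m l).dist ⟨i, a⟩ ⟨i, b⟩ ≤ max a.val b.val := by
  rcases le_total a.val b.val with h | h
  · obtain ⟨p, hp⟩ := Kmn_exists_walk_of_add_eq i (b.val - a.val) a b (by omega)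
    have := dist_le p
    omega
  · obtain ⟨p, hp⟩ := Kmn_exists_walk_of_add_eq i (a.val - b.val) b a (by omega)
    have := dist_le p
    rw [dist_comm] at this
    omega

theorem Kmn_dist_le {i j : Fin m} (hij : i ≠ j) (a : Fin (l i)) (b : Fin (l j)) :
    (Kmn m l).dist ⟨i, a⟩ ⟨j, b⟩ ≤ a.val + l j := by
  obtain ⟨p, hp⟩ := Kmn_exists_walk_of_add_eq i a.val ⟨0, a.pos⟩ a (by simp)
  obtain ⟨q, hq⟩ := Kmn_exists_walk_of_add_eq j b.val ⟨0, b.pos⟩ b (by simp)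
  have hadj : (Kmn m l).Adj ⟨i, ⟨0, a.pos⟩⟩ ⟨j, ⟨0, b.pos⟩⟩ :=
    (fromRel_adj _ _ _).2
      ⟨fun he => hij (Sigma.mk.inj he).1, .inl (.inr ⟨hij, rfl, rfl⟩)⟩
  have := dist_le (p.reverse.append (.cons hadj q))
  simp only [Walk.length_append, Walk.length_reverse, Walk.length_cons, hp, hq] at this
  omega

/-- The eccentricity of a vertex at height `a` on a path is at most `a + M` when the other paths
have at most `M` vertices and its own has at most `M + 1`. -/
theorem Kmn_ecc_le {M : ℕ} (i : Fin m) (a : Fin (l i)) (hi : l i ≤ M + 1)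
    (h : ∀ j, i ≠ j → l j ≤ M) : ecc (Kmn m l) ⟨i, a⟩ ≤ a.val + M := by
  refine ciSup_le' fun ⟨j, b⟩ => ?_
  by_cases hij : i = j
  · subst hij
    have := Kmn_dist_same_le i a b
    omega
  · have := Kmn_dist_le hij a b
    have := h j hij
    omega

/-- Summing a bound on the eccentricities when all paths have `Q` or `Q + 1` vertices. -/
theorem Kmn_totalEcc_add_le {Q : ℕ} (hl : ∀ i, Q ≤ l i ∧ l i ≤ Q + 1) (δ : Fin m → ℕ)
    (h : ∀ i (a : Fin (l i)), ecc (Kmn m l) ⟨i, a⟩ + δ i ≤ a.val + Q + 1) :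
    totalEcc (Kmn m l) + (∑ i, l i * δ i + m * ∑ a ∈ Finset.range (Q + 1), (Q - a)) ≤
      (∑ i, l i) * (2 * Q + 1) := by
  have hpath : ∀ i, ∑ a : Fin (l i), (Q - a.val) = ∑ a ∈ Finset.range (Q + 1), (Q - a) := by
    intro i
    rw [Fin.sum_univ_eq_sum_range (fun a => Q - a)]
    have := hl i
    obtain h | h : l i = Q ∨ l i = Q + 1 := by omega
    · simp [h, Finset.sum_range_succ]
    · rw [h]
  have hm : m * ∑ a ∈ Finset.range (Q + 1), (Q - a) =
      ∑ i : Fin m, ∑ a : Fin (l i), (Q - a.val) := by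
    simp [hpath]
  rw [hm, totalEcc, Fintype.sum_sigma, ← Finset.sum_add_distrib, ← Finset.sum_add_distrib,
    Finset.sum_mul]
  refine Finset.sum_le_sum fun i _ => ?_
  calc _ = ∑ a : Fin (l i), (ecc (Kmn m l) ⟨i, a⟩ + (δ i + (Q - a.val))) := by
        simp [Finset.sum_add_distrib]
    _ ≤ ∑ _a : Fin (l i), (2 * Q + 1) := by
        refine Finset.sum_le_sum fun a _ => ?_
        have := h i a
        have := hl i
        omega
    _ = _ := by simp

end CompleteWithPaths

/-- A balanced composition of a number in `(m * Q, m * (Q + 1)]` has parts `Q` and `Q + 1`. -/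
theorem parts_mem_of_balanced {m : ℕ} {l : Fin m → ℕ} {Q : ℕ}
    (hbal : ∀ i j, l i ≤ l j + 1) (hlo : m * Q < ∑ i, l i) (hhi : ∑ i, l i ≤ m * (Q + 1))
    (i : Fin m) : Q ≤ l i ∧ l i ≤ Q + 1 := by
  constructor
  · by_contra! h
    have : ∑ j, l j ≤ m * Q := by
      simpa using Finset.sum_le_card_nsmul Finset.univ l Q fun j _ => by have := hbal j i; omega
    omega
  · by_contra! h
    have : ∑ _j : Fin m, (Q + 1) < ∑ j, l j :=
      Finset.sum_lt_sum (fun j _ => by have := hbal i j; omega) ⟨i, Finset.mem_univ i, h⟩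
    simp at this
    omega

/-- Parts `≥ Q` with sum `m * Q + 1` are all equal to `Q`, except for a single `Q + 1`. -/
theorem exists_unique_large_part {m : ℕ} {l : Fin m → ℕ} {Q : ℕ} (hl : ∀ i, Q ≤ l i)
    (hsum : ∑ i, l i = m * Q + 1) :
    ∃ i₀, l i₀ = Q + 1 ∧ ∀ j, i₀ ≠ j → l j = Q := by
  have hlt : ∑ _i : Fin m, Q < ∑ i, l i := by simp [hsum]
  obtain ⟨i₀, -, hi₀⟩ := Finset.exists_lt_of_sum_lt hlt
  have hle : ∀ j, Q + (if i₀ = j then 1 else 0) ≤ l j := by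
    intro j
    have := hl j
    split_ifs with h
    · subst h
      omega
    · omega
  have hs : ∑ j, (Q + if i₀ = j then 1 else 0) = ∑ j, l j := by
    simp [Finset.sum_add_distrib, hsum]
  have heq := (Finset.sum_eq_sum_iff_of_le fun j _ => hle j).1 hs
  refine ⟨i₀, by simpa using (heq i₀ (Finset.mem_univ _)).symm, fun j hj => ?_⟩
  simpa [hj] using (heq j (Finset.mem_univ _)).symm

-- STATEMENT 14
theorem stmt14 {V : Type*} [Fintype V] (G : SimpleGraph V) (hG : G.Connected)
    (n s : ℕ) (hn : 2 ≤ n) (hs : s ≤ n - 2) (hcard : Fintype.card V = n)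
    (hcut : {w | IsCutVertex G w}.ncard = s)
    (l' : Fin (n - s) → ℕ) (hpos' : ∀ i, 1 ≤ l' i) (hsum' : ∑ i, l' i = n)
    (hbal : ∀ i j, l' i ≤ l' j + 1) :
    totalEcc (Kmn (n - s) l') ≤ totalEcc G := by
  classical
  have : Nontrivial V := Fintype.one_lt_card_iff_nontrivial.1 (by omega)
  have hnc : (Finset.univ.filter fun v => ¬ IsCutVertex G v).card = n - s := by
    have h₁ := Finset.card_filter_add_card_filter_not (s := Finset.univ) fun v => IsCutVertex G v
    rw [Finset.card_univ, hcard] at h₁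
    have h₂ : (Finset.univ.filter fun v => IsCutVertex G v).card = s := by
      rw [← hcut, ← Set.ncard_coe_finset]
      simp
    omega
  have hm : 0 < n - s := by omega
  generalize n - s = m at *
  obtain ⟨Q, r, hr, hQ⟩ : ∃ Q r, r < m ∧ n = m * Q + r + 1 :=
    ⟨(n - 1) / m, (n - 1) % m, Nat.mod_lt _ hm, by have := Nat.div_add_mod (n - 1) m; omega⟩
  have hl := parts_mem_of_balanced hbal (Q := Q) (by omega) (by rw [mul_add]; omega)
  have hbound : ∀ v, n ≤ 1 + ecc G v * m := fun v => by
    simpa [hcard, hnc] using card_le_one_add_mul_ecc hG v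
  have hlow : ∀ v, Q ≤ ecc G v := fun v => by
    by_contra! h
    have := Nat.mul_le_mul_left m h
    have := hbound v
    rw [mul_comm (ecc G v)] at this
    rw [Nat.mul_succ] at *
    omega
  have hlevel : ∀ k, (Finset.univ.filter fun v => ecc G v = k).card ≤ m := fun k =>
    (card_ecc_level_le hG k).trans_eq hnc
  rcases Nat.eq_zero_or_pos r with rfl | hrpos
  · have hone : (Finset.univ.filter fun v => ecc G v = Q).card ≤ 1 := by
      refine Finset.card_le_one.2 fun x hx y hy => ?_
      simp only [Finset.mem_filter, Finset.mem_univ, true_and] at hx hy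
      refine eq_of_card_eq hG ?_ (hy.trans hx.symm)
      rw [hcard, hnc, hx, hQ]
      ring
    have hG' := card_mul_le_sum_add (ecc G) m 1 Q hlow hone hlevel
    obtain ⟨i₀, hi₀, hother⟩ := exists_unique_large_part (fun i => (hl i).1) (by omega)
    have hK := Kmn_totalEcc_add_le hl (fun i => if i₀ = i then 1 else 0) fun i a => by
      split_ifs with h
      · subst h
        have := Kmn_ecc_le i₀ a hi₀.le fun j hj => (hother j hj).le
        omega
      · have := Kmn_ecc_le (M := Q + 1) i a ((hl i).2.trans (Nat.le_succ _)) fun j _ => (hl j).2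
        omega
    simp only [mul_ite, mul_one, mul_zero, Finset.sum_ite_eq, Finset.mem_univ, if_true, hi₀,
      hsum'] at hK
    rw [hcard] at hG'
    simp only [totalEcc] at hK ⊢
    omega
  · have hzero : (Finset.univ.filter fun v => ecc G v = Q).card ≤ 0 := by
      rw [Nat.le_zero, Finset.card_eq_zero, Finset.filter_eq_empty_iff]
      intro v _ hv
      have := hbound v
      rw [hv, mul_comm] at this
      omega
    have hG' := card_mul_le_sum_add (ecc G) m 0 Q hlow hzero hlevel
    have hK := Kmn_totalEcc_add_le hl (fun _ => 0) fun i a =>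
      Kmn_ecc_le (M := Q + 1) i a ((hl i).2.trans (Nat.le_succ _)) fun j _ => (hl j).2
    simp only [mul_zero, Finset.sum_const_zero, hsum'] at hK
    rw [hcard] at hG'
    simp only [totalEcc] at hK ⊢
    omega
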